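/- Let A be a reduced commutative ring and let u be an element of the Laurent polynomial ring A[T, T⁻¹] such that u^m = 1 for some integer m ≥ 1. Then u is a constant Laurent polynomial, i.e. u lies in the image of the canonical inclusion A → A[T, T⁻¹]. Equivalently, for every m ≥ 1 the group of m-th roots of unity of A[T, T⁻¹] coincides with the group of m-th roots of unity of A. -/

import Mathlib

namespace LaurentPolynomial

/-- Over a reduced ring, a root of unity has no coefficients in positive degree. -/
theorem coeff_eq_zero_of_pow_eq_one {A : Type*} [CommRing A] [IsReduced A] {m : ℕ} (hm : m ≠ 0)
    {u : LaurentPolynomial A} (hu : u ^ m = 1) {k : ℤ} (hk : 0 < k) : u.coeff k = 0 := by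
  nontriviality A
  obtain ⟨n, f, hf⟩ := exists_T_pow u
  have hpow : f ^ m = Polynomial.X ^ (m * n) := by
    apply Polynomial.toLaurent_injective
    simp [hf, mul_pow, hu, T_pow]
  have hf0 : f ≠ 0 := by
    rintro rfl
    rw [zero_pow hm] at hpow
    exact (Polynomial.monic_X_pow (R := A) (m * n)).ne_zero hpow.symm
  have hdeg : f.natDegree = n := by
    have h := Polynomial.natDegree_pow' (p := f) (n := m)
      (pow_ne_zero m (Polynomial.leadingCoeff_ne_zero.mpr hf0))
    rw [hpow, Polynomial.natDegree_X_pow] at h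
    exact (Nat.eq_of_mul_eq_mul_left (Nat.pos_of_ne_zero hm) h).symm
  lift k to ℕ using hk.le
  have hcoeff : u.coeff (k : ℤ) = (u * T n).coeff ((k + n : ℕ) : ℤ) := by
    rw [T, Nat.cast_add,
      AddMonoidAlgebra.coeff_mul_single_eq_coeff_mul (k : ℤ) (by simp), mul_one]
  have hfcoeff : (Polynomial.toLaurent f).coeff ((k + n : ℕ) : ℤ) = f.coeff (k + n) := by
    rw [coeff_toLaurent]
    exact Finsupp.mapDomain_apply Nat.cast_injective _ _
  rw [hcoeff, ← hf, hfcoeff]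
  exact Polynomial.coeff_eq_zero_of_natDegree_lt (by omega)

end LaurentPolynomial

/-- Let `A` be a reduced commutative ring and `u ∈ A[T,T⁻¹]` a Laurent
polynomial with `u ^ m = 1` for some `m ≥ 1`. Then `u` is a constant Laurent polynomial,
i.e. `u` lies in the image of the canonical inclusion `A → A[T,T⁻¹]`. -/
theorem stmt6 {A : Type*} [CommRing A] [IsReduced A]
    (m : ℕ) (hm : 1 ≤ m) (u : LaurentPolynomial A) (hu : u ^ m = 1) :
    ∃ a : A, u = LaurentPolynomial.C a := by
  have hm0 : m ≠ 0 := by omega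
  refine ⟨u.coeff 0, LaurentPolynomial.ext fun k ↦ ?_⟩
  rw [LaurentPolynomial.C_apply]
  split_ifs with hk
  · rw [hk]
  rcases lt_or_gt_of_ne hk with hneg | hpos
  · have hinv : LaurentPolynomial.invert u ^ m = 1 := by rw [← map_pow, hu, map_one]
    simpa using LaurentPolynomial.coeff_eq_zero_of_pow_eq_one hm0 hinv (neg_pos.mpr hneg)
  · exact LaurentPolynomial.coeff_eq_zero_of_pow_eq_one hm0 hu hpos
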